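/- Fix a vertex v. Let e₁ = {a₁,b₁} and e₂ = {a₂,b₂} be edges with all four endpoints in v^↓. Suppose that for i = 1, 2 the minimal mincut of e_i exists and equals u_{e_i}^↓ ∖ l_{e_i}^↓ for vertices u_{e_i}, l_{e_i} with l_{e_i} ∈ u_{e_i}^⇓, and suppose l_{e_i} ∉ v^↓ and u_{e_i} ∈ v^⇑ for i = 1, 2 (so each of these minimal mincuts contains all of v^↓). Then the minimal mincuts of e₁ and e₂ coincide: u_{e₁}^↓ ∖ l_{e₁}^↓ = u_{e₂}^↓ ∖ l_{e₂}^↓. -/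

import Mathlib

open Finset

variable {V : Type*} [Fintype V] [DecidableEq V]

/-- `cutW w X Y` is `C(X,Y) = Σ_{x∈X} Σ_{y∈Y} w(x,y)`. -/
def cutW (w : V → V → ℝ) (X Y : Finset V) : ℝ := ∑ x ∈ X, ∑ y ∈ Y, w x y

/-- `C(X) := C(X, V ∖ X)`. -/
def cutVal (w : V → V → ℝ) (X : Finset V) : ℝ := cutW w X Xᶜ

/-- A cut is a nonempty proper subset of `V`. -/
def IsCut (X : Finset V) : Prop := X.Nonempty ∧ X ≠ Finset.univ

/-- A mincut is a cut of minimum weight. -/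
def IsMincut (w : V → V → ℝ) (X : Finset V) : Prop :=
  IsCut X ∧ ∀ Y : Finset V, IsCut Y → cutVal w X ≤ cutVal w Y

/-- `X` and `Y` cross if `X∩Y`, `X∖Y`, `Y∖X` and `V∖(X∪Y)` are all nonempty. -/
def Crosses (X Y : Finset V) : Prop :=
  (X ∩ Y).Nonempty ∧ (X \ Y).Nonempty ∧ (Y \ X).Nonempty ∧ ((X ∪ Y)ᶜ).Nonempty

/-- A minimal mincut of a vertex `v`: a mincut containing `v` but not the root `r`,
of minimum cardinality among all such mincuts. -/
def IsMinimalMincutOfVertex (w : V → V → ℝ) (r v : V) (X : Finset V) : Prop :=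
  IsMincut w X ∧ v ∈ X ∧ r ∉ X ∧
    ∀ Y : Finset V, IsMincut w Y → v ∈ Y → r ∉ Y → X.card ≤ Y.card

/-- An edge is an unordered pair of distinct vertices with positive weight. -/
def IsEdge (w : V → V → ℝ) (u₁ u₂ : V) : Prop := u₁ ≠ u₂ ∧ 0 < w u₁ u₂

/-- A minimal mincut of an edge `{u₁,u₂}`: a mincut containing both endpoints but not the
root `r`, of minimum cardinality among all such mincuts. -/
def IsMinimalMincutOfEdge (w : V → V → ℝ) (r u₁ u₂ : V) (X : Finset V) : Prop :=
  IsEdge w u₁ u₂ ∧ IsMincut w X ∧ u₁ ∈ X ∧ u₂ ∈ X ∧ r ∉ X ∧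
    ∀ Y : Finset V, IsMincut w Y → u₁ ∈ Y → u₂ ∈ Y → r ∉ Y → X.card ≤ Y.card

/-- `Anc par u v` : `u` is an ancestor of `v` in the rooted tree with parent map `par`
(the ancestor relation is reflexive, so `v ∈ u^↓`). -/
def Anc (par : V → V) (u v : V) : Prop :=
  Relation.ReflTransGen (fun a b => b = par a) v u

open scoped Classical

/-- `desc par u = u^↓`, the set of descendants of `u`. -/
noncomputable def desc (par : V → V) (u : V) : Finset V :=
  Finset.univ.filter (fun v => Anc par u v)

/-- `top(S)`: the vertices of `S` having no strict ancestor in `S`. -/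
noncomputable def topSet (par : V → V) (S : Finset V) : Finset V :=
  S.filter (fun v => ∀ u ∈ S, Anc par u v → u = v)

/-- `L_u`: the valid lower vertices below `u`, i.e. the strict descendants `v` of `u`
such that `x^↓ ∖ v^↓` is a mincut for some ancestor `x` of `u`. -/
noncomputable def lowerSet (w : V → V → ℝ) (par : V → V) (u : V) : Finset V :=
  Finset.univ.filter (fun v =>
    Anc par u v ∧ v ≠ u ∧ ∃ x : V, Anc par x u ∧ IsMincut w (desc par x \ desc par v))

/-- `path(a,b)`: the set of vertices on the tree path between `a` and `b`. -/
noncomputable def pathSet (par : V → V) (lca : V → V → V) (a b : V) : Finset V :=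
  Finset.univ.filter (fun x => Anc par (lca a b) x ∧ (Anc par x a ∨ Anc par x b))

theorem cutVal_eq_sum (w : V → V → ℝ) (X : Finset V) :
    cutVal w X = ∑ x, ∑ y, (if x ∈ X ∧ y ∉ X then w x y else 0) := by
  unfold cutVal cutW
  have h : ∀ x, (∑ y, (if x ∈ X ∧ y ∉ X then w x y else 0))
      = if x ∈ X then ∑ y ∈ Xᶜ, w x y else 0 := by
    intro x
    by_cases hx : x ∈ X
    · simp only [hx, true_and, if_true]
      rw [← Finset.sum_filter]
      congr 1
      ext y
      simp
    · simp [hx]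
  simp only [h]
  rw [← Finset.sum_filter]
  congr 1
  ext y
  simp

theorem cutVal_submod (w : V → V → ℝ) (hnonneg : ∀ x y, 0 ≤ w x y) (A B : Finset V) :
    cutVal w (A ∩ B) + cutVal w (A ∪ B) ≤ cutVal w A + cutVal w B := by
  simp only [cutVal_eq_sum, ← Finset.sum_add_distrib]
  refine Finset.sum_le_sum fun x _ => Finset.sum_le_sum fun y _ => ?_
  have := hnonneg x y
  by_cases h1 : x ∈ A <;> by_cases h2 : x ∈ B <;> by_cases h3 : y ∈ A <;>
    by_cases h4 : y ∈ B <;> simp [h1, h2, h3, h4, this]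

theorem mincut_inter (w : V → V → ℝ) (hnonneg : ∀ x y, 0 ≤ w x y) (A B : Finset V) (r a : V)
    (hA : IsMincut w A) (hB : IsMincut w B) (haA : a ∈ A) (haB : a ∈ B)
    (hrA : r ∉ A) (hrB : r ∉ B) : IsMincut w (A ∩ B) := by
  have hc : IsCut (A ∩ B) := ⟨⟨a, by simp [haA, haB]⟩, fun h => hrA (by
    have : r ∈ A ∩ B := h ▸ Finset.mem_univ r
    exact (Finset.mem_inter.1 this).1)⟩
  have hu : IsCut (A ∪ B) := ⟨⟨a, by simp [haA]⟩, fun h => by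
    have : r ∈ A ∪ B := h ▸ Finset.mem_univ r
    simp [hrA, hrB] at this⟩
  refine ⟨hc, fun Y hY => ?_⟩
  have h1 := cutVal_submod w hnonneg A B
  have h2 := hB.2 _ hu
  have h3 := hA.2 Y hY
  linarith

theorem desc_sub (par : V → V) (v a u l : V) (ha : Anc par v a)
    (haX : a ∈ desc par u \ desc par l) (hl : ¬ Anc par v l) (hu : Anc par u v)
    (x : V) (hx : Anc par v x) : x ∈ desc par u \ desc par l := by
  simp only [desc, Finset.mem_sdiff, Finset.mem_filter, Finset.mem_univ, true_and] at haX ⊢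
  refine ⟨Relation.ReflTransGen.trans hx hu, fun hlx => ?_⟩
  have hun : Relator.RightUnique (fun a b : V => b = par a) := by
    intro p q s h1 h2
    exact h1.trans h2.symm
  rcases Relation.ReflTransGen.total_of_right_unique hun hx hlx with h | h
  · exact haX.2 (Relation.ReflTransGen.trans ha h)
  · exact hl h

theorem minimal_sub (w : V → V → ℝ) (hnonneg : ∀ x y, 0 ≤ w x y) (r a b : V) (A B : Finset V)
    (hA : IsMinimalMincutOfEdge w r a b A) (hB : IsMincut w B) (haB : a ∈ B) (hbB : b ∈ B)
    (hrB : r ∉ B) : A ⊆ B := by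
  obtain ⟨_, hm, ha, hb, hr, hmin⟩ := hA
  have h := hmin (A ∩ B) (mincut_inter w hnonneg A B r a hm hB ha haB hr hrB)
    (by simp [ha, haB]) (by simp [hb, hbB]) (by simp [hr])
  have := Finset.eq_of_subset_of_card_le (Finset.inter_subset_left (s₁ := A) (s₂ := B)) h
  exact Finset.inter_eq_left.1 this

/-- if two edges `e₁, e₂` have all endpoints in `v^↓`, and each has a
comparable strictly 2-respecting minimal mincut `u_{e_i}^↓ ∖ l_{e_i}^↓` with
`l_{e_i} ∉ v^↓` and `u_{e_i} ∈ v^⇑`, then these two minimal mincuts coincide. -/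
theorem same_minimal_mincut_through_v
    (r : V) (w : V → V → ℝ)
    (hcard : 1 < Fintype.card V)
    (hsym : ∀ x y, w x y = w y x)
    (hnonneg : ∀ x y, 0 ≤ w x y)
    (hdiag : ∀ x, w x x = 0)
    (par : V → V) (dep : V → ℕ)
    (hpar_r : par r = r)
    (hdep : ∀ v : V, v ≠ r → dep v = dep (par v) + 1)
    (hdep0 : ∀ v : V, dep v = 0 → v = r)
    (hspan : ∀ v : V, v ≠ r → 0 < w v (par v))
    (v a₁ b₁ a₂ b₂ ue₁ le₁ ue₂ le₂ : V)
    (ha₁ : Anc par v a₁) (hb₁ : Anc par v b₁)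
    (ha₂ : Anc par v a₂) (hb₂ : Anc par v b₂)
    (hle₁ : Anc par ue₁ le₁ ∧ le₁ ≠ ue₁)
    (hle₂ : Anc par ue₂ le₂ ∧ le₂ ≠ ue₂)
    (hmin₁ : IsMinimalMincutOfEdge w r a₁ b₁ (desc par ue₁ \ desc par le₁))
    (hmin₂ : IsMinimalMincutOfEdge w r a₂ b₂ (desc par ue₂ \ desc par le₂))
    (hl₁ : ¬ Anc par v le₁) (hl₂ : ¬ Anc par v le₂)
    (hu₁ : Anc par ue₁ v ∧ ue₁ ≠ v) (hu₂ : Anc par ue₂ v ∧ ue₂ ≠ v) :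
    desc par ue₁ \ desc par le₁ = desc par ue₂ \ desc par le₂ := by
  have h₁ := desc_sub par v a₁ ue₁ le₁ ha₁ hmin₁.2.2.1 hl₁ hu₁.1
  have h₂ := desc_sub par v a₂ ue₂ le₂ ha₂ hmin₂.2.2.1 hl₂ hu₂.1
  exact Finset.Subset.antisymm
    (minimal_sub w hnonneg r a₁ b₁ _ _ hmin₁ hmin₂.2.1 (h₂ _ ha₁) (h₂ _ hb₁) hmin₂.2.2.2.2.1)
    (minimal_sub w hnonneg r a₂ b₂ _ _ hmin₂ hmin₁.2.1 (h₁ _ ha₂) (h₁ _ hb₂) hmin₁.2.2.2.2.1)
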